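/- Let Ψ = {A_1, …, A_m} be a finite set of nonnegative n×n matrices with μ(A_i) > 0 for all i, let Â_i = A_i/μ(A_i), and let Ŝ = Â_1 ⊕ ⋯ ⊕ Â_m be the entrywise maximum of the normalised matrices. The following are equivalent: (i) μ(Ŝ) = 1; (ii) there exists a positive vector x with A_i⊗x ≤ μ(A_i)·x for all i = 1,…,m; (iii) μ is submultiplicative on Ψ, i.e. μ(A_{j_1}⊗⋯⊗A_{j_p}) ≤ μ(A_{j_1})⋯μ(A_{j_p}) for every p ≥ 1 and all indices j_1,…,j_p ∈ {1,…,m}. -/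

import Mathlib

open Filter Relation

namespace MaxAlg

/-- Max-algebraic action of a matrix on a vector: `(A ⊗ x) i = max_j A i j * x j`. -/
noncomputable def maxVec {n : ℕ} (A : Fin n → Fin n → ℝ) (x : Fin n → ℝ) : Fin n → ℝ :=
  fun i => ⨆ j, A i j * x j

/-- Max-algebraic matrix product: `(A ⊗ B) i k = max_j A i j * B j k`. -/
noncomputable def maxMul {n : ℕ} (A B : Fin n → Fin n → ℝ) : Fin n → Fin n → ℝ :=
  fun i k => ⨆ j, A i j * B j k

/-- The weight of the cycle determined by a list `[i₁, …, i_k]`,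
namely `A i₁ i₂ * ⋯ * A i_{k-1} i_k * A i_k i₁`. -/
noncomputable def cycleProd {n : ℕ} (A : Fin n → Fin n → ℝ) (l : List (Fin n)) : ℝ :=
  ((l.zip (l.rotate 1)).map fun p => A p.1 p.2).prod

/-- The maximal cycle geometric mean of `A`: the supremum over all cycles of distinct
nodes of the k-th root of the cycle weight. -/
noncomputable def mu {n : ℕ} (A : Fin n → Fin n → ℝ) : ℝ :=
  sSup {c | ∃ l : List (Fin n), l ≠ [] ∧ l.Nodup ∧ c = cycleProd A l ^ ((l.length : ℝ)⁻¹)}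

/-- `C_{A,r}`: the positive vectors with `A ⊗ x ≤ r x`. -/
def Cset {n : ℕ} (A : Fin n → Fin n → ℝ) (r : ℝ) : Set (Fin n → ℝ) :=
  {x | (∀ i, 0 < x i) ∧ ∀ i, maxVec A x i ≤ r * x i}

/-- A critical cycle: a cycle of distinct nodes attaining `mu A`. -/
def IsCriticalCycle {n : ℕ} (A : Fin n → Fin n → ℝ) (l : List (Fin n)) : Prop :=
  l ≠ [] ∧ l.Nodup ∧ cycleProd A l ^ ((l.length : ℝ)⁻¹) = mu A

/-- `(i,j) ∈ E^C(A)`: the edge `(i,j)` lies on some critical cycle. -/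
def criticalEdge {n : ℕ} (A : Fin n → Fin n → ℝ) (i j : Fin n) : Prop :=
  ∃ l : List (Fin n), IsCriticalCycle A l ∧ (i, j) ∈ l.zip (l.rotate 1)

/-- `i ∈ N^C(A)`: the node `i` lies on some critical cycle. -/
def criticalNode {n : ℕ} (A : Fin n → Fin n → ℝ) (i : Fin n) : Prop :=
  ∃ l : List (Fin n), IsCriticalCycle A l ∧ i ∈ l

/-- Irreducibility: the digraph of `A` (edge `(i,j)` iff `A i j > 0`) is strongly connected. -/
def Irred {n : ℕ} (A : Fin n → Fin n → ℝ) : Prop :=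
  ∀ i j, Relation.ReflTransGen (fun a b => 0 < A a b) i j

/-- Max-algebraic product of a word of matrices from the family `A`. -/
noncomputable def wordProd {n m : ℕ} (A : Fin m → Fin n → Fin n → ℝ) :
    List (Fin m) → (Fin n → Fin n → ℝ)
  | [] => fun i j => if i = j then 1 else 0
  | [j] => A j
  | j :: k :: w => maxMul (A j) (wordProd A (k :: w))

/-- The max version of the generalised spectral radius
`μ̂(Ψ) = limsup_{p→∞} (max_{ψ ∈ Ψ^p_⊗} μ(ψ))^{1/p}`. -/
noncomputable def genSpecRad {n m : ℕ} (A : Fin m → Fin n → Fin n → ℝ) : ℝ :=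
  Filter.limsup
    (fun p : ℕ =>
      (sSup {c | ∃ w : List (Fin m), w.length = p ∧ c = mu (wordProd A w)}) ^ ((p : ℝ)⁻¹))
    Filter.atTop

/-- `S = A₁ ⊕ ⋯ ⊕ A_m`: the entrywise maximum of the family. -/
noncomputable def Smat {n m : ℕ} (A : Fin m → Fin n → Fin n → ℝ) : Fin n → Fin n → ℝ :=
  fun i j => ⨆ k, A k i j

/-- The relative error function `e_A(x) = max_{i,j} A i j * x j / x i`. -/
noncomputable def errF {n : ℕ} (A : Fin n → Fin n → ℝ) (x : Fin n → ℝ) : ℝ :=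
  ⨆ i, ⨆ j, A i j * x j / x i

/-- A symmetrically reciprocal (SR) matrix: positive, with unit diagonal and
`A i j * A j i = 1` for `i ≠ j`. -/
def IsSR {n : ℕ} (A : Fin n → Fin n → ℝ) : Prop :=
  (∀ i j, 0 < A i j) ∧ (∀ i, A i i = 1) ∧ ∀ i j, i ≠ j → A i j * A j i = 1

/-- Max-algebraic matrix powers. -/
noncomputable def maxPow {n : ℕ} (B : Fin n → Fin n → ℝ) : ℕ → (Fin n → Fin n → ℝ)
  | 0 => fun i j => if i = j then 1 else 0
  | p + 1 => maxMul B (maxPow B p)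

/-- The Kleene star `B* = I ⊕ B ⊕ B⊗² ⊕ ⋯ ⊕ B⊗^{n-1}`. -/
noncomputable def kleeneStar {n : ℕ} (B : Fin n → Fin n → ℝ) : Fin n → Fin n → ℝ :=
  fun i j => ⨆ p : Fin n, maxPow B p i j

/-- The weight of the walk through the successive entries of a list. -/
noncomputable def walkProd {n : ℕ} (A : Fin n → Fin n → ℝ) : List (Fin n) → ℝ
  | [] => 1
  | [_] => 1
  | i :: j :: l => A i j * walkProd A (j :: l)

section

variable {n m : ℕ} {A : Fin n → Fin n → ℝ}

lemma walkProd_nonneg (hA : ∀ i j, 0 ≤ A i j) (l : List (Fin n)) : 0 ≤ walkProd A l := by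
  fun_induction walkProd A l with
  | case1 => exact zero_le_one
  | case2 => exact zero_le_one
  | case3 i j l ih => exact mul_nonneg (hA i j) ih

lemma walkProd_append_cons (A : Fin n → Fin n → ℝ) (p : List (Fin n)) (i : Fin n)
    (q : List (Fin n)) :
    walkProd A (p ++ i :: q) = walkProd A (p ++ [i]) * walkProd A (i :: q) := by
  induction p with
  | nil => simp [walkProd]
  | cons a p ih =>
    cases p with
    | nil => simp [walkProd]
    | cons b p =>
      simp only [List.cons_append, walkProd] at ih ⊢
      rw [ih, mul_assoc]

lemma zip_prod_eq_walkProd (A : Fin n → Fin n → ℝ) (i a : Fin n) (l : List (Fin n)) :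
    (((i :: l).zip (l ++ [a])).map fun p => A p.1 p.2).prod = walkProd A (i :: (l ++ [a])) := by
  induction l generalizing i with
  | nil => simp [walkProd]
  | cons j l ih =>
    have := ih j
    simp only [List.cons_append, walkProd, ← this]
    simp

lemma cycleProd_cons (A : Fin n → Fin n → ℝ) (i : Fin n) (l : List (Fin n)) :
    cycleProd A (i :: l) = walkProd A (i :: (l ++ [i])) := by
  rw [← zip_prod_eq_walkProd]
  simp [cycleProd]

lemma cycleProd_nonneg (hA : ∀ i j, 0 ≤ A i j) (l : List (Fin n)) : 0 ≤ cycleProd A l :=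
  List.prod_nonneg (by
    intro a ha
    obtain ⟨p, -, rfl⟩ := List.mem_map.1 ha
    exact hA _ _)

lemma finite_nodup_lists (α : Type*) [Fintype α] : {l : List α | l.Nodup}.Finite :=
  (List.finite_length_le α (Fintype.card α)).subset fun _ hl => hl.length_le_card

lemma finite_cycleMeans (A : Fin n → Fin n → ℝ) :
    {c | ∃ l : List (Fin n), l ≠ [] ∧ l.Nodup ∧
      c = cycleProd A l ^ ((l.length : ℝ)⁻¹)}.Finite := by
  refine ((finite_nodup_lists (Fin n)).image
    fun l => cycleProd A l ^ ((l.length : ℝ)⁻¹)).subset ?_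
  rintro c ⟨l, -, hl, rfl⟩
  exact ⟨l, hl, rfl⟩

lemma le_mu (A : Fin n → Fin n → ℝ) {l : List (Fin n)} (hl : l ≠ []) (hd : l.Nodup) :
    cycleProd A l ^ ((l.length : ℝ)⁻¹) ≤ mu A :=
  le_csSup (finite_cycleMeans A).bddAbove ⟨l, hl, hd, rfl⟩

lemma apply_self_le_mu (A : Fin n → Fin n → ℝ) (i : Fin n) : A i i ≤ mu A := by
  simpa [cycleProd] using le_mu A (l := [i]) (by simp) (by simp)

lemma mu_le {r : ℝ} (hA : ∀ i j, 0 ≤ A i j) (hr : 0 ≤ r)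
    (h : ∀ l : List (Fin n), l ≠ [] → l.Nodup → cycleProd A l ≤ r ^ l.length) : mu A ≤ r := by
  refine Real.sSup_le ?_ hr
  rintro c ⟨l, hl, hd, rfl⟩
  calc _ ≤ (r ^ l.length) ^ ((l.length : ℝ)⁻¹) :=
        Real.rpow_le_rpow (cycleProd_nonneg hA l) (h l hl hd) (by positivity)
    _ = r := Real.pow_rpow_inv_natCast hr (by simpa using hl)

lemma exists_cycleProd_eq_mu_pow (hA : ∀ i j, 0 ≤ A i j) (hmu : 0 < mu A) :
    ∃ l : List (Fin n), l ≠ [] ∧ l.Nodup ∧ cycleProd A l = mu A ^ l.length := by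
  have hne : {c | ∃ l : List (Fin n), l ≠ [] ∧ l.Nodup ∧
      c = cycleProd A l ^ ((l.length : ℝ)⁻¹)}.Nonempty := by
    by_contra h
    rw [Set.not_nonempty_iff_eq_empty] at h
    rw [mu, h, Real.sSup_empty] at hmu
    exact hmu.false
  obtain ⟨l, hl, hd, h⟩ := hne.csSup_mem (finite_cycleMeans A)
  refine ⟨l, hl, hd, ?_⟩
  rw [mu, h, Real.rpow_inv_natCast_pow (cycleProd_nonneg hA l) (by simpa using hl)]

lemma walkProd_mul_le {r : ℝ} {x : Fin n → ℝ} (hA : ∀ i j, 0 ≤ A i j) (hr : 0 ≤ r)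
    (h : ∀ i j, A i j * x j ≤ r * x i) (l : List (Fin n)) (i a : Fin n) :
    walkProd A (i :: (l ++ [a])) * x a ≤ r ^ (l.length + 1) * x i := by
  induction l generalizing i with
  | nil => simpa [walkProd] using h i a
  | cons j l ih =>
    calc _ = A i j * (walkProd A (j :: (l ++ [a])) * x a) := by simp [walkProd, mul_assoc]
      _ ≤ A i j * (r ^ (l.length + 1) * x j) := mul_le_mul_of_nonneg_left (ih j) (hA i j)
      _ = r ^ (l.length + 1) * (A i j * x j) := by ring
      _ ≤ r ^ (l.length + 1) * (r * x i) := mul_le_mul_of_nonneg_left (h i j) (by positivity)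
      _ = _ := by simp only [List.length_cons]; ring

lemma mu_le_of_mul_le {r : ℝ} {x : Fin n → ℝ} (hA : ∀ i j, 0 ≤ A i j) (hr : 0 ≤ r)
    (hx : ∀ i, 0 < x i) (h : ∀ i j, A i j * x j ≤ r * x i) : mu A ≤ r := by
  refine mu_le hA hr fun l hl _ => ?_
  cases l with
  | nil => exact absurd rfl hl
  | cons i l =>
    rw [cycleProd_cons]
    exact le_of_mul_le_mul_right (walkProd_mul_le hA hr h l i i) (hx i)

/-- A nonnegative matrix with `mu A ≤ 1` has a positive subeigenvector: take for `x i` the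
largest weight of a path of distinct nodes starting at `i`. -/
lemma exists_pos_mul_le (hA : ∀ i j, 0 ≤ A i j) (hmu : mu A ≤ 1) :
    ∃ x : Fin n → ℝ, (∀ i, 0 < x i) ∧ ∀ i j, A i j * x j ≤ x i := by
  have hmax : ∀ i, ∃ l : List (Fin n), (i :: l).Nodup ∧
      ∀ l', (i :: l').Nodup → walkProd A (i :: l') ≤ walkProd A (i :: l) := fun i => by
    have hfin : {l : List (Fin n) | (i :: l).Nodup}.Finite :=
      (finite_nodup_lists (Fin n)).subset fun l hl => (List.nodup_cons.1 hl).2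
    exact Set.exists_max_image _ (fun l => walkProd A (i :: l)) hfin
      ⟨[], List.nodup_singleton i⟩
  choose p hp hpmax using hmax
  refine ⟨fun i => walkProd A (i :: p i), fun i => ?_, fun i j => ?_⟩
  · exact zero_lt_one.trans_le (by simpa [walkProd] using hpmax i [] (by simp))
  · by_cases hi : i ∈ j :: p j
    · obtain ⟨s, t, hst⟩ := List.append_of_mem hi
      have hd := hp j
      rw [hst] at hd
      have hcyc : (i :: s).Nodup := by
        have := hd.of_append_left
        have h2 := List.nodup_middle.1 hd
        rw [List.nodup_cons, List.mem_append, not_or] at h2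
        exact List.nodup_cons.2 ⟨h2.1.1, this⟩
      have hle : cycleProd A (i :: s) ≤ 1 := by
        have h1 := (le_mu A (by simp) hcyc).trans hmu
        by_contra! hlt
        exact h1.not_gt (Real.one_lt_rpow hlt (by simp; positivity))
      have hwalk : A i j * walkProd A (j :: p j) = walkProd A ((i :: s) ++ i :: t) := by
        rw [List.cons_append, ← hst]
        rfl
      rw [hwalk, walkProd_append_cons, List.cons_append, ← cycleProd_cons]
      exact (mul_le_of_le_one_left (walkProd_nonneg hA _) hle).trans
        (hpmax i t hd.of_append_right)
    · exact hpmax i (j :: p j) (List.nodup_cons.2 ⟨hi, hp j⟩)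

lemma mul_le_maxMul (A B : Fin n → Fin n → ℝ) (i j k : Fin n) :
    A i j * B j k ≤ maxMul A B i k :=
  le_ciSup (f := fun j => A i j * B j k) (Set.finite_range _).bddAbove j

lemma mul_le_maxVec (A : Fin n → Fin n → ℝ) (x : Fin n → ℝ) (i j : Fin n) :
    A i j * x j ≤ maxVec A x i :=
  le_ciSup (f := fun j => A i j * x j) (Set.finite_range _).bddAbove j

variable {F : Fin m → Fin n → Fin n → ℝ}

lemma wordProd_nonneg (hF : ∀ k i j, 0 ≤ F k i j) (w : List (Fin m)) (i j : Fin n) :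
    0 ≤ wordProd F w i j := by
  fun_induction wordProd F w generalizing i j with
  | case1 => dsimp only; split_ifs <;> simp
  | case2 k => exact hF k i j
  | case3 k l w ih => exact Real.iSup_nonneg fun a => mul_nonneg (hF k i a) (ih a j)

lemma wordProd_cons (F : Fin m → Fin n → Fin n → ℝ) (k : Fin m) {w : List (Fin m)}
    (hw : w ≠ []) : wordProd F (k :: w) = maxMul (F k) (wordProd F w) := by
  cases w with
  | nil => exact absurd rfl hw
  | cons l w => rfl

lemma wordProd_mul_le {r : Fin m → ℝ} {x : Fin n → ℝ} (hF : ∀ k i j, 0 ≤ F k i j)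
    (hr : ∀ k, 0 ≤ r k) (hx : ∀ i, 0 < x i) (h : ∀ k i j, F k i j * x j ≤ r k * x i)
    (w : List (Fin m)) (hw : w ≠ []) (i j : Fin n) :
    wordProd F w i j * x j ≤ (w.map r).prod * x i := by
  induction w generalizing i with
  | nil => exact absurd rfl hw
  | cons k w ih =>
    by_cases hw' : w = []
    · subst hw'
      simpa [wordProd] using h k i j
    · have hprod : 0 ≤ (w.map r).prod := List.prod_nonneg (by simpa using fun k _ => hr k)
      have : Nonempty (Fin n) := ⟨i⟩
      rw [wordProd_cons F k hw', maxMul, Real.iSup_mul_of_nonneg (hx j).le]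
      refine ciSup_le fun a => ?_
      calc F k i a * wordProd F w a j * x j = F k i a * (wordProd F w a j * x j) := by ring
        _ ≤ F k i a * ((w.map r).prod * x a) := mul_le_mul_of_nonneg_left (ih hw' a) (hF k i a)
        _ = (w.map r).prod * (F k i a * x a) := by ring
        _ ≤ (w.map r).prod * (r k * x i) := mul_le_mul_of_nonneg_left (h k i a) hprod
        _ = _ := by simp only [List.map_cons, List.prod_cons]; ring

/-- Along a walk in a matrix each of whose entries is an entry of some `F k / r k`, one can read
off a word whose product dominates the weight of the walk. -/
lemma exists_word_walkProd_le {r : Fin m → ℝ} (hF : ∀ k i j, 0 ≤ F k i j) (hr : ∀ k, 0 < r k)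
    (h : ∀ i j, ∃ k, A i j = F k i j / r k) (l : List (Fin n)) (i a : Fin n) :
    ∃ w : List (Fin m), w ≠ [] ∧
      walkProd A (i :: (l ++ [a])) * (w.map r).prod ≤ wordProd F w i a := by
  induction l generalizing i with
  | nil =>
    obtain ⟨k, hk⟩ := h i a
    exact ⟨[k], by simp, by simp [walkProd, wordProd, hk, (hr k).ne']⟩
  | cons j l ih =>
    obtain ⟨k, hk⟩ := h i j
    obtain ⟨w, hw, hle⟩ := ih j
    refine ⟨k :: w, by simp, ?_⟩
    rw [wordProd_cons F k hw]
    refine le_trans ?_ (mul_le_maxMul _ _ i j a)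
    refine le_trans (le_of_eq ?_) (mul_le_mul_of_nonneg_left hle (hF k i j))
    have := (hr k).ne'
    simp only [List.cons_append, walkProd, hk, List.map_cons, List.prod_cons]
    field_simp

lemma walkProd_le_pow_mul {B : Fin n → Fin n → ℝ} {r : ℝ} (hA : ∀ i j, 0 ≤ A i j) (hr : 0 ≤ r)
    (hB : ∀ i j, 0 ≤ B i j) (h : ∀ i j, A i j ≤ r * B i j) (l : List (Fin n)) (i a : Fin n) :
    walkProd A (i :: (l ++ [a])) ≤ r ^ (l.length + 1) * walkProd B (i :: (l ++ [a])) := by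
  induction l generalizing i with
  | nil => simpa [walkProd] using h i a
  | cons j l ih =>
    calc _ = A i j * walkProd A (j :: (l ++ [a])) := by simp [walkProd]
      _ ≤ (r * B i j) * (r ^ (l.length + 1) * walkProd B (j :: (l ++ [a]))) :=
        mul_le_mul (h i j) (ih j) (walkProd_nonneg hA _) (mul_nonneg hr (hB i j))
      _ = _ := by simp only [List.length_cons, List.cons_append, walkProd]; ring

lemma one_le_mu {B : Fin n → Fin n → ℝ} (hA : ∀ i j, 0 ≤ A i j) (hmu : 0 < mu A)
    (hB : ∀ i j, 0 ≤ B i j) (h : ∀ i j, A i j ≤ mu A * B i j) : 1 ≤ mu B := by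
  obtain ⟨l, hl, hd, heq⟩ := exists_cycleProd_eq_mu_pow hA hmu
  refine le_trans (Real.one_le_rpow ?_ (by positivity)) (le_mu B hl hd)
  cases l with
  | nil => exact absurd rfl hl
  | cons i l =>
    have := walkProd_le_pow_mul hA hmu.le hB h l i i
    rw [← cycleProd_cons, ← cycleProd_cons, heq, List.length_cons] at this
    exact (le_mul_iff_one_le_right (by positivity)).1 this

end

/-- for a family with `μ(A_i) > 0`, normalising `Â_i = A_i/μ(A_i)` and
`Ŝ = Â₁ ⊕ ⋯ ⊕ Â_m`, the following are equivalent: (i) `μ(Ŝ) = 1`; (ii) there is a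
common positive subeigenvector; (iii) `μ` is submultiplicative on the family. -/
theorem stmt7 {n m : ℕ} (hm : 0 < m) (A : Fin m → Fin n → Fin n → ℝ)
    (hA : ∀ k i j, 0 ≤ A k i j) (hmu : ∀ k, 0 < mu (A k)) :
    List.TFAE [
      mu (fun i j => ⨆ k, A k i j / mu (A k)) = 1,
      ∃ x : Fin n → ℝ, (∀ i, 0 < x i) ∧ ∀ k i, maxVec (A k) x i ≤ mu (A k) * x i,
      ∀ w : List (Fin m), w ≠ [] →
        mu (wordProd A w) ≤ (w.map fun k => mu (A k)).prod
    ] := by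
  have : Nonempty (Fin m) := ⟨⟨0, hm⟩⟩
  set S : Fin n → Fin n → ℝ := fun i j => ⨆ k, A k i j / mu (A k)
  have hSnn : ∀ i j, 0 ≤ S i j := fun i j =>
    Real.iSup_nonneg fun k => div_nonneg (hA k i j) (hmu k).le
  have hAS : ∀ k i j, A k i j ≤ mu (A k) * S i j := fun k i j => by
    rw [← div_le_iff₀' (hmu k)]
    exact le_ciSup (f := fun k => A k i j / mu (A k)) (Set.finite_range _).bddAbove k
  have hSatt : ∀ i j, ∃ k, S i j = A k i j / mu (A k) := fun i j => by
    obtain ⟨k, hk⟩ := exists_eq_ciSup_of_finite (f := fun k => A k i j / mu (A k))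
    exact ⟨k, hk.symm⟩
  tfae_have 1 → 2 := by
    intro h
    obtain ⟨x, hx, hSx⟩ := exists_pos_mul_le hSnn h.le
    refine ⟨x, hx, fun k i => Real.iSup_le (fun j => ?_) (mul_nonneg (hmu k).le (hx i).le)⟩
    calc A k i j * x j ≤ mu (A k) * S i j * x j :=
          mul_le_mul_of_nonneg_right (hAS k i j) (hx j).le
      _ = mu (A k) * (S i j * x j) := mul_assoc _ _ _
      _ ≤ mu (A k) * x i := mul_le_mul_of_nonneg_left (hSx i j) (hmu k).le
  tfae_have 2 → 3 := by
    rintro ⟨x, hx, hAx⟩ w hw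
    refine mu_le_of_mul_le (wordProd_nonneg hA w)
      (List.prod_nonneg (by simpa using fun k _ => (hmu k).le)) hx ?_
    exact wordProd_mul_le hA (fun k => (hmu k).le) hx
      (fun k i j => (mul_le_maxVec _ _ i j).trans (hAx k i)) w hw
  tfae_have 3 → 1 := by
    intro h
    refine le_antisymm (mu_le hSnn zero_le_one fun l hl _ => ?_)
      (one_le_mu (hA ⟨0, hm⟩) (hmu _) hSnn (hAS _))
    cases l with
    | nil => exact absurd rfl hl
    | cons i l =>
      obtain ⟨w, hw, hle⟩ := exists_word_walkProd_le hA hmu hSatt l i i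
      have hpos : 0 < (w.map fun k => mu (A k)).prod :=
        List.prod_pos (by simpa using fun k _ => hmu k)
      rw [one_pow, cycleProd_cons]
      exact (mul_le_iff_le_one_left hpos).1
        (hle.trans ((apply_self_le_mu _ i).trans (h w hw)))
  tfae_finish

end MaxAlg
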